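/- arXiv:2211.16055 — 8 statements merged into one kernel-verified Lean document; each statement's English description precedes it below -/
import Mathlib

section
/- Let K be a division ring, let A, B, C, D ∈ K be pairwise distinct, and let n ∈ ℤ with (n : K) ≠ 0 (the image of n in K is nonzero). Then the natural dilation by n leaves the cross-ratio invariant: c_r(n•A, n•B; n•C, n•D) = c_r(A, B; C, D), where n•X denotes the n-th integer multiple of X in the additive group of K. -/
def crossRatio {K : Type*} [DivisionRing K] (A B C D : K) : K :=
  ((A - D)⁻¹ * (B - D)) * ((B - C)⁻¹ * (A - C))

theorem inv_zsmul_mul_zsmul {K : Type*} [DivisionRing K] {n : ℤ} (hn : (n : K) ≠ 0)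
    (x y : K) : (n • x)⁻¹ * (n • y) = x⁻¹ * y := by
  rw [zsmul_eq_mul, zsmul_eq_mul, mul_inv_rev, mul_assoc, inv_mul_cancel_left₀ hn]

theorem crossRatio_invariant_natural_dilation {K : Type*} [DivisionRing K]
    (A B C D : K) (hAB : A ≠ B) (hAC : A ≠ C) (hAD : A ≠ D)
    (hBC : B ≠ C) (hBD : B ≠ D) (hCD : C ≠ D)
    (n : ℤ) (hn : (n : K) ≠ 0) :
    crossRatio (n • A) (n • B) (n • C) (n • D) = crossRatio A B C D := by
  simp only [crossRatio, ← zsmul_sub, inv_zsmul_mul_zsmul hn]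
end

section
/- Let K be a division ring, let A, B, C, D ∈ K be pairwise distinct, and let P ∈ K with P ≠ 0. Then the inversion with point P leaves the cross-ratio invariant: c_r(P·A, P·B; P·C, P·D) = c_r(A, B; C, D). -/
theorem crossRatio_invariant_inversion {K : Type*} [DivisionRing K]
    (A B C D : K) (hAB : A ≠ B) (hAC : A ≠ C) (hAD : A ≠ D)
    (hBC : B ≠ C) (hBD : B ≠ D) (hCD : C ≠ D)
    (P : K) (hP : P ≠ 0) :
    crossRatio (P * A) (P * B) (P * C) (P * D) = crossRatio A B C D := by
  have cancel (x y : K) : (P * x)⁻¹ * (P * y) = x⁻¹ * y := by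
    rw [mul_inv_rev, mul_assoc, inv_mul_cancel_left₀ hP]
  simp only [crossRatio, ← mul_sub, cancel]
end

section
/- Let K be a division ring and let A, B, C, D ∈ K be pairwise distinct. Then 1 − c_r(A, B; C, D) = c_r(A, C; B, D), where 1 is the multiplicative identity of K. -/
theorem one_sub_crossRatio {K : Type*} [DivisionRing K]
    (A B C D : K) (hAB : A ≠ B) (hAC : A ≠ C) (hAD : A ≠ D)
    (hBC : B ≠ C) (hBD : B ≠ D) (hCD : C ≠ D) :
    1 - crossRatio A B C D = crossRatio A C B D := by
  have hu : B - C ≠ 0 := sub_ne_zero.mpr hBC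
  have key : A - D - (B - D) * ((B - C)⁻¹ * (A - C)) =
      (C - D) * ((C - B)⁻¹ * (A - B)) := by
    have hBD' : B - D = (B - C) + (C - D) := by abel
    have hAB' : A - B = (A - C) - (B - C) := by abel
    rw [hBD', hAB', ← neg_sub B C, inv_neg, add_mul, mul_inv_cancel_left₀ hu, neg_mul,
      mul_sub (B - C)⁻¹ (A - C), inv_mul_cancel₀ hu, neg_sub, mul_sub (C - D), mul_one]
    abel
  unfold crossRatio
  rw [mul_assoc, mul_assoc, ← key, mul_sub (A - D)⁻¹ (A - D), inv_mul_cancel₀ (sub_ne_zero.mpr hAD)]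
end

section
/- Let K be a division ring and let A, B, C, D ∈ K be pairwise distinct. Then c_r(A, D; B, C) = 1 − (c_r(A, B; C, D))⁻¹, where 1 is the multiplicative identity of K. -/
theorem crossRatio_ADBC {K : Type*} [DivisionRing K]
    (A B C D : K) (hAB : A ≠ B) (hAC : A ≠ C) (hAD : A ≠ D)
    (hBC : B ≠ C) (hBD : B ≠ D) (hCD : C ≠ D) :
    crossRatio A D B C = 1 - (crossRatio A B C D)⁻¹ := by
  obtain ⟨a, rfl⟩ : ∃ a, A = a + D := ⟨A - D, by simp⟩
  obtain ⟨b, rfl⟩ : ∃ b, B = b + D := ⟨B - D, by simp⟩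
  obtain ⟨c, rfl⟩ : ∃ c, C = c + D := ⟨C - D, by simp⟩
  have hb : b ≠ 0 := by simpa using hBD
  have hac : a - c ≠ 0 := sub_ne_zero.mpr fun h => hAC (by rw [h])
  have key : c * b⁻¹ * (a - b) = (a - c) - (b - c) * b⁻¹ * a := by
    simp only [mul_sub, sub_mul, mul_inv_cancel₀ hb, inv_mul_cancel_right₀ hb, one_mul]
    abel
  calc crossRatio (a + D) (D) (b + D) (c + D)
      = (a - c)⁻¹ * (c * b⁻¹ * (a - b)) := by
        simp [crossRatio, sub_add_cancel_right, inv_neg, mul_assoc]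
    _ = 1 - (a - c)⁻¹ * ((b - c) * b⁻¹ * a) := by
        rw [key, mul_sub, inv_mul_cancel₀ hac]
    _ = 1 - (crossRatio (a + D) (b + D) (c + D) D)⁻¹ := by
        simp [crossRatio, mul_assoc]
end

section
/- Let K be a division ring and let A, B, C, D ∈ K be pairwise distinct. Then c_r(A, D; C, B) = (c_r(A, B; C, D) − 1)⁻¹ · c_r(A, B; C, D), where 1 is the multiplicative identity of K. -/
theorem crossRatio_sub_one {K : Type*} [DivisionRing K] {A B C D : K}
    (hAD : A ≠ D) (hBC : B ≠ C) :
    crossRatio A B C D - 1 = (A - D)⁻¹ * ((C - D) * (B - C)⁻¹ * (A - B)) := by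
  have hAD' : A - D ≠ 0 := sub_ne_zero.2 hAD
  have hBC' : B - C ≠ 0 := sub_ne_zero.2 hBC
  have hAC : (B - C)⁻¹ * (A - C) = (B - C)⁻¹ * (A - B) + 1 := by
    rw [← sub_add_sub_cancel A B C, mul_add, inv_mul_cancel₀ hBC']
  have hCD : (C - D) * (B - C)⁻¹ = (B - D) * (B - C)⁻¹ - 1 := by
    rw [← sub_sub_sub_cancel_left D C B, sub_mul, mul_inv_cancel₀ hBC']
  rw [crossRatio, hAC, hCD, ← inv_mul_cancel₀ hAD', mul_assoc, ← mul_sub,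
    inv_mul_cancel₀ hAD']
  congr 1
  noncomm_ring

theorem sub_mul_inv_mul_mul_inv_sub {K : Type*} [DivisionRing K] {u v : K}
    (hv : v ≠ 0) (huv : u ≠ v) :
    (u - v) * v⁻¹ * (u * (u - v)⁻¹) = u * v⁻¹ := by
  have huv' : u - v ≠ 0 := sub_ne_zero.2 huv
  rw [← mul_assoc, mul_inv_eq_iff_eq_mul₀ huv', sub_mul, mul_inv_cancel₀ hv, sub_mul, one_mul,
    mul_sub, inv_mul_cancel_right₀ hv]

theorem crossRatio_ADCB {K : Type*} [DivisionRing K]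
    (A B C D : K) (hAB : A ≠ B) (hAC : A ≠ C) (hAD : A ≠ D)
    (hBC : B ≠ C) (hBD : B ≠ D) (hCD : C ≠ D) :
    crossRatio A D C B = (crossRatio A B C D - 1)⁻¹ * crossRatio A B C D := by
  have hAB' : A - B ≠ 0 := sub_ne_zero.2 hAB
  have hAD' : A - D ≠ 0 := sub_ne_zero.2 hAD
  have hBC' : B - C ≠ 0 := sub_ne_zero.2 hBC
  have hCD' : C - D ≠ 0 := sub_ne_zero.2 hCD
  have hne : crossRatio A B C D - 1 ≠ 0 := by
    rw [crossRatio_sub_one hAD hBC]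
    exact mul_ne_zero (inv_ne_zero hAD')
      (mul_ne_zero (mul_ne_zero hCD' (inv_ne_zero hBC')) hAB')
  have hneg : (D - B) * (D - C)⁻¹ = (B - D) * (C - D)⁻¹ := by
    rw [← neg_sub B D, ← neg_sub C D, inv_neg, neg_mul_neg]
  have key : (C - D) * (B - C)⁻¹ * ((B - D) * (C - D)⁻¹) = (B - D) * (B - C)⁻¹ := by
    have h := sub_mul_inv_mul_mul_inv_sub (u := B - D) hBC' (fun h => hCD (sub_right_inj.1 h).symm)
    rwa [sub_sub_sub_cancel_left] at h
  rw [eq_inv_mul_iff_mul_eq₀ hne, crossRatio_sub_one hAD hBC]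
  calc (A - D)⁻¹ * ((C - D) * (B - C)⁻¹ * (A - B)) * crossRatio A D C B
      = (A - D)⁻¹ * ((C - D) * (B - C)⁻¹ * ((A - B) * (A - B)⁻¹) *
          ((D - B) * (D - C)⁻¹) * (A - C)) := by
        simp only [crossRatio, mul_assoc]
    _ = (A - D)⁻¹ * ((B - D) * (B - C)⁻¹ * (A - C)) := by
        rw [mul_inv_cancel₀ hAB', mul_one, hneg, key]
    _ = crossRatio A B C D := by
        simp only [crossRatio, mul_assoc]
end

section
/- Let K be a division ring and let A, B, C, D ∈ K be pairwise distinct and all nonzero. Then c_r(A⁻¹, B⁻¹; C⁻¹, D⁻¹) = A · c_r(A, B; C, D) · A⁻¹. -/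
theorem inv_sub_inv_eq_neg_inv_mul_sub_mul_inv {K : Type*} [DivisionRing K] {X Y : K}
    (hX : X ≠ 0) (hY : Y ≠ 0) : X⁻¹ - Y⁻¹ = -(Y⁻¹ * (X - Y) * X⁻¹) := by
  rw [mul_sub, sub_mul, inv_mul_cancel₀ hY, mul_assoc, mul_inv_cancel₀ hX, mul_one, one_mul,
    neg_sub]

theorem crossRatio_inv_points {K : Type*} [DivisionRing K]
    (A B C D : K) (hAB : A ≠ B) (hAC : A ≠ C) (hAD : A ≠ D)
    (hBC : B ≠ C) (hBD : B ≠ D) (hCD : C ≠ D)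
    (hA : A ≠ 0) (hB : B ≠ 0) (hC : C ≠ 0) (hD : D ≠ 0) :
    crossRatio A⁻¹ B⁻¹ C⁻¹ D⁻¹ = A * crossRatio A B C D * A⁻¹ := by
  unfold crossRatio
  rw [inv_sub_inv_eq_neg_inv_mul_sub_mul_inv hA hD, inv_sub_inv_eq_neg_inv_mul_sub_mul_inv hB hD,
    inv_sub_inv_eq_neg_inv_mul_sub_mul_inv hB hC, inv_sub_inv_eq_neg_inv_mul_sub_mul_inv hA hC]
  simp only [inv_neg, neg_mul_neg, mul_inv_rev, inv_inv, mul_assoc, mul_inv_cancel_left₀ hD,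
    mul_inv_cancel_left₀ hC, inv_mul_cancel_left₀ hB]
end

section
/- Let K be a division ring and let A, B, C ∈ K be pairwise distinct and all nonzero. Then r(A⁻¹, B⁻¹; C⁻¹) = B · r(A, B; C) · A⁻¹. -/
def ratio {K : Type*} [DivisionRing K] (A B C : K) : K :=
  (B - C)⁻¹ * (A - C)

/-- The difference of two inverses in a division ring, factored with `c⁻¹` on the left. -/
theorem inv_sub_inv_eq_neg_inv_mul_sub_mul_inv_s12 {K : Type*} [DivisionRing K] {a c : K}
    (ha : a ≠ 0) (hc : c ≠ 0) : a⁻¹ - c⁻¹ = -(c⁻¹ * (a - c) * a⁻¹) := by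
  rw [mul_sub, sub_mul, mul_assoc, mul_inv_cancel₀ ha, inv_mul_cancel₀ hc, mul_one, one_mul,
    neg_sub]

theorem ratio_inv_points {K : Type*} [DivisionRing K]
    (A B C : K) (hAB : A ≠ B) (hAC : A ≠ C) (hBC : B ≠ C)
    (hA : A ≠ 0) (hB : B ≠ 0) (hC : C ≠ 0) :
    ratio A⁻¹ B⁻¹ C⁻¹ = B * ratio A B C * A⁻¹ := by
  unfold ratio
  rw [inv_sub_inv_eq_neg_inv_mul_sub_mul_inv_s12 hA hC, inv_sub_inv_eq_neg_inv_mul_sub_mul_inv_s12 hB hC,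
    inv_neg, neg_mul_neg, mul_inv_rev, mul_inv_rev, inv_inv, inv_inv]
  simp only [mul_assoc, mul_inv_cancel_left₀ hC]
end

section
/- Let K be a division ring and let A, B, C, D ∈ K be pairwise distinct. If the ratio-points r(A, B; C) and r(A, B; D) commute in K (i.e. r(A,B;C)·r(A,B;D) = r(A,B;D)·r(A,B;C)), then c_r(A, B; C, D) = c_r(B, A; D, C). -/
theorem crossRatio_eq_inv_ratio_mul_ratio {K : Type*} [DivisionRing K] (A B C D : K) :
    crossRatio A B C D = (ratio A B D)⁻¹ * ratio A B C := by
  simp only [crossRatio, ratio, mul_inv_rev, inv_inv]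

theorem crossRatio_swap_eq_ratio_mul_inv_ratio {K : Type*} [DivisionRing K] (A B C D : K) :
    crossRatio B A D C = ratio A B C * (ratio A B D)⁻¹ := by
  simp only [crossRatio, ratio, mul_inv_rev, inv_inv]

theorem crossRatio_swap_of_ratio_comm {K : Type*} [DivisionRing K]
    (A B C D : K) (hAB : A ≠ B) (hAC : A ≠ C) (hAD : A ≠ D)
    (hBC : B ≠ C) (hBD : B ≠ D) (hCD : C ≠ D)
    (hcomm : ratio A B C * ratio A B D = ratio A B D * ratio A B C) :
    crossRatio A B C D = crossRatio B A D C := by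
  rw [crossRatio_eq_inv_ratio_mul_ratio, crossRatio_swap_eq_ratio_mul_inv_ratio]
  exact (Commute.inv_right₀ hcomm).eq.symm
end
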